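/- Let q be a prime power with q ≡ 1 (mod 4), set t = (q−1)/4, let T be a generator of the group of multiplicative characters of F_q^×, and let λ ∈ F_q satisfy λ⁴ = 1. Define S₂ := (3/(q−1))·Σ_{j=0}^{q−2} (g(T^j)²·g(T^{2t+j})² / g(T^{4j}))·T^{4j}(4λ). Then S₂ = −6q + 3q·T^t(−1). -/

import Mathlib

/-- The standard additive character of a finite field `F` of characteristic `p`,
built from a primitive `p`-th root of unity `ζ` in `ℂ`:  `θ x = ζ ^ tr(x)`. -/
noncomputable def stdAddChar {F : Type*} [Field F] [Fintype F] (p : ℕ) [CharP F p]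
    [Algebra (ZMod p) F] (ζ : ℂ) (x : F) : ℂ :=
  ζ ^ (Algebra.trace (ZMod p) F x).val

/-- The Gauss sum `g(χ) = ∑ₓ χ(x) θ(x)` with respect to the standard additive character. -/
noncomputable def gaussSum' {F : Type*} [Field F] [Fintype F] (p : ℕ) [CharP F p]
    [Algebra (ZMod p) F] (ζ : ℂ) (χ : MulChar F ℂ) : ℂ :=
  ∑ x : F, χ x * stdAddChar p ζ x

section QuadraticCharacter

variable (F : Type*) [Field F] [Fintype F]

open Classical in
/-- The quadratic character of a finite field with complex values. -/
noncomputable def complexQuadraticChar : MulChar F ℂ :=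
  (quadraticChar F).ringHomComp (Int.castRingHom ℂ)

variable {F}

open Classical in
lemma complexQuadraticChar_apply (a : F) :
    complexQuadraticChar F a = (quadraticChar F a : ℂ) := rfl

lemma complexQuadraticChar_isQuadratic : (complexQuadraticChar F).IsQuadratic := by
  classical
  exact (quadraticChar_isQuadratic F).comp _

lemma complexQuadraticChar_sq : complexQuadraticChar F ^ 2 = 1 :=
  complexQuadraticChar_isQuadratic.sq_eq_one

lemma complexQuadraticChar_ne_one (hF : ringChar F ≠ 2) : complexQuadraticChar F ≠ 1 := by
  classical
  exact (MulChar.ringHomComp_ne_one_iff (RingHom.injective_int _)).mpr (quadraticChar_ne_one hF)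

lemma complexQuadraticChar_sq_apply {a : F} (ha : a ≠ 0) :
    complexQuadraticChar F (a ^ 2) = 1 := by
  classical
  simp [complexQuadraticChar_apply, quadraticChar_sq_one' ha]

lemma MulChar.sq_eq_one_iff {χ : MulChar F ℂ} :
    χ ^ 2 = 1 ↔ χ = 1 ∨ χ = complexQuadraticChar F := by
  classical
  constructor
  · intro h
    rw [or_iff_not_imp_left]
    intro h1
    obtain ⟨n, hn⟩ := MulChar.ne_one_iff.mp h1
    have hval : ∀ a : Fˣ, χ a ^ 2 = 1 := fun a ↦ by
      rw [← MulChar.pow_apply_coe, h, MulChar.one_apply_coe]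
    have hsq : ∀ a : F, a ≠ 0 → quadraticChar F a = 1 → χ a = 1 := by
      intro a ha h
      obtain ⟨y, rfl⟩ := (quadraticChar_one_iff_isSquare ha).mp h
      have hy : y ≠ 0 := left_ne_zero_of_mul ha
      simpa [sq] using hval (Units.mk0 y hy)
    have hn' : quadraticChar F n = -1 :=
      (quadraticChar_dichotomy n.ne_zero).resolve_left fun h ↦ hn (hsq n n.ne_zero h)
    have hn1 : χ n = -1 := (_root_.sq_eq_one_iff.mp (hval n)).resolve_left hn
    refine MulChar.ext fun a ↦ ?_
    rw [complexQuadraticChar_apply]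
    rcases quadraticChar_dichotomy a.ne_zero with ha | ha
    · simp [ha, hsq a a.ne_zero ha]
    · have := hsq (a * n) (mul_ne_zero a.ne_zero n.ne_zero) (by rw [map_mul, ha, hn']; norm_num)
      rw [map_mul, hn1] at this
      rw [ha]
      push_cast
      linear_combination -this
  · rintro (rfl | rfl)
    · exact one_pow 2
    · exact complexQuadraticChar_sq

lemma jacobiSum_self (hF : ringChar F ≠ 2) {χ : MulChar F ℂ} (hχ : χ ≠ 1) :
    χ 4 * jacobiSum χ χ = jacobiSum χ (complexQuadraticChar F) := by
  classical
  have h2 : (2 : F) ≠ 0 := Ring.two_ne_zero hF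
  let e : F ≃ F := (Equiv.mulLeft₀ 2 h2).trans (Equiv.subLeft 1)
  calc χ 4 * jacobiSum χ χ = ∑ x, χ (1 - (e x) ^ 2) := by
        rw [jacobiSum, Finset.mul_sum]
        refine Finset.sum_congr rfl fun x _ ↦ ?_
        rw [← map_mul, ← map_mul]
        congr 1
        simp only [e, Equiv.trans_apply, Equiv.mulLeft₀_apply, Equiv.subLeft_apply]
        ring
    _ = ∑ x, χ (1 - x ^ 2) := e.sum_comp fun x ↦ χ (1 - x ^ 2)
    _ = ∑ a, ∑ x with x ^ 2 = a, χ (1 - x ^ 2) :=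
        (Finset.sum_fiberwise _ _ _).symm
    _ = ∑ a, (complexQuadraticChar F a + 1) * χ (1 - a) := by
        refine Finset.sum_congr rfl fun a _ ↦ ?_
        have hcard : ((Finset.univ.filter fun x : F ↦ x ^ 2 = a).card : ℤ)
            = quadraticChar F a + 1 := by
          rw [← quadraticChar_card_sqrts hF a]
          congr 2
          ext
          simp
        have hcard' : ((Finset.univ.filter fun x : F ↦ x ^ 2 = a).card : ℂ)
            = complexQuadraticChar F a + 1 := by
          rw [complexQuadraticChar_apply]
          exact_mod_cast congrArg (Int.cast : ℤ → ℂ) hcard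
        rw [← hcard', Finset.sum_congr rfl (g := fun _ ↦ χ (1 - a))
          (fun x hx ↦ by rw [(Finset.mem_filter.mp hx).2])]
        simp
    _ = jacobiSum χ (complexQuadraticChar F) := by
        rw [jacobiSum_comm, jacobiSum]
        simp only [add_mul, one_mul, Finset.sum_add_distrib]
        have hsum : ∑ x, χ (1 - x) = 0 := by
          rw [← MulChar.sum_eq_zero_of_ne_one hχ]
          exact (Equiv.subLeft (1 : F)).sum_comp fun x ↦ χ x
        rw [hsum, add_zero]

lemma gaussSum_ne_zero {ψ : AddChar F ℂ} (hψ : ψ.IsPrimitive) (χ : MulChar F ℂ) :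
    gaussSum χ ψ ≠ 0 := by
  by_cases hχ : χ = 1
  · have : ψ ≠ 1 := by
      rintro rfl
      exact hψ one_ne_zero (by ext; simp)
    rw [hχ, gaussSum_one_left this]
    simp
  · exact gaussSum_ne_zero_of_nontrivial (by simp) hχ hψ

/-- The Hasse-Davenport product formula for the quadratic character. -/
lemma gaussSum_mul_gaussSum_quadratic (hF : ringChar F ≠ 2) {ψ : AddChar F ℂ}
    (hψ : ψ.IsPrimitive) (χ : MulChar F ℂ) :
    χ 4 * (gaussSum χ ψ * gaussSum (χ * complexQuadraticChar F) ψ) =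
      gaussSum (χ ^ 2) ψ * gaussSum (complexQuadraticChar F) ψ := by
  have h2 : (2 : F) ≠ 0 := Ring.two_ne_zero hF
  have h4 : (4 : F) = 2 ^ 2 := by norm_num
  by_cases hχ : χ ^ 2 = 1
  · rcases MulChar.sq_eq_one_iff.mp hχ with rfl | rfl
    · rw [one_mul, one_pow, h4, MulChar.one_apply (isUnit_iff_ne_zero.mpr (pow_ne_zero 2 h2)),
        one_mul]
    · rw [h4, complexQuadraticChar_sq_apply h2, ← sq, complexQuadraticChar_sq, one_mul, mul_comm]
  · have hχ1 : χ ≠ 1 := by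
      rintro rfl
      exact hχ (one_pow 2)
    have hχφ : χ * complexQuadraticChar F ≠ 1 := fun h ↦ hχ (by
      rw [← mul_one (χ ^ 2), ← complexQuadraticChar_sq, ← mul_pow, h, one_pow, complexQuadraticChar_sq])
    have e1 := jacobiSum_mul_nontrivial (χ := χ) (φ := χ) (by rwa [← sq]) ψ
    have e2 := jacobiSum_mul_nontrivial hχφ ψ
    rw [← jacobiSum_self hF hχ1] at e2
    rw [← sq] at e1
    refine mul_left_cancel₀ (gaussSum_ne_zero hψ χ) ?_
    linear_combination gaussSum (χ ^ 2) ψ * e2 -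
      χ 4 * gaussSum (χ * complexQuadraticChar F) ψ * e1

lemma ringChar_ne_two_of_card (h41 : Fintype.card F % 4 = 1) : ringChar F ≠ 2 := fun h ↦ by
  have := FiniteField.even_card_iff_char_two.mp h
  omega

lemma complexQuadraticChar_neg_one (h41 : Fintype.card F % 4 = 1) :
    complexQuadraticChar F (-1) = 1 := by
  obtain ⟨i, hi⟩ := FiniteField.isSquare_neg_one_iff.mpr (by omega : Fintype.card F % 4 ≠ 3)
  rw [hi, ← sq, complexQuadraticChar_sq_apply]
  rintro rfl
  simp at hi

lemma gaussSum_quadratic_sq (h41 : Fintype.card F % 4 = 1) {ψ : AddChar F ℂ}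
    (hψ : ψ.IsPrimitive) :
    gaussSum (complexQuadraticChar F) ψ ^ 2 = Fintype.card F := by
  rw [gaussSum_sq (complexQuadraticChar_ne_one (ringChar_ne_two_of_card h41))
    complexQuadraticChar_isQuadratic hψ, complexQuadraticChar_neg_one h41, one_mul]

open Classical in
lemma gaussSum_quotient_eq_jacobiSum (h41 : Fintype.card F % 4 = 1) {ψ : AddChar F ℂ}
    (hψ : ψ.IsPrimitive) (χ : MulChar F ℂ) {lam : F} (hlam : lam ^ 4 = 1) :
    gaussSum χ ψ ^ 2 * gaussSum (complexQuadraticChar F * χ) ψ ^ 2 / gaussSum (χ ^ 4) ψ *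
        (χ ^ 4) (4 * lam) =
      Fintype.card F * (jacobiSum (χ ^ 2) (complexQuadraticChar F) -
        if χ ^ 2 = complexQuadraticChar F then (Fintype.card F - 1 : ℂ) else 0) := by
  have hF := ringChar_ne_two_of_card h41
  have hl : (χ ^ 4) (4 * lam) = χ 4 ^ 4 := by
    rw [MulChar.pow_apply' _ (by norm_num), map_mul, mul_pow, ← map_pow χ lam, hlam, map_one,
      mul_one]
  have e1 := gaussSum_mul_gaussSum_quadratic hF hψ χ
  have e2 := gaussSum_mul_gaussSum_quadratic hF hψ (χ ^ 2)
  rw [← pow_mul, MulChar.pow_apply' _ two_ne_zero] at e2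
  have hg := gaussSum_quadratic_sq h41 hψ
  have hne := gaussSum_ne_zero hψ (χ ^ 4)
  have hne' := gaussSum_ne_zero hψ (χ ^ 2 * complexQuadraticChar F)
  have hterm : gaussSum χ ψ ^ 2 * gaussSum (complexQuadraticChar F * χ) ψ ^ 2 /
      gaussSum (χ ^ 4) ψ * (χ ^ 4) (4 * lam) =
      Fintype.card F * (gaussSum (χ ^ 2) ψ * gaussSum (complexQuadraticChar F) ψ /
        gaussSum (χ ^ 2 * complexQuadraticChar F) ψ) := by
    rw [hl, mul_comm (complexQuadraticChar F) χ, ← hg]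
    norm_num only at e2
    field_simp
    rw [show ∀ a b c d : ℂ, a ^ 2 * b ^ 2 * c ^ 4 * d = (c * (a * b)) ^ 2 * (c ^ 2 * d) by
      intros; ring, e1]
    linear_combination gaussSum (χ ^ 2) ψ * gaussSum (complexQuadraticChar F) ψ ^ 2 * e2
  rw [hterm]
  congr 1
  split_ifs with h
  · have hψ1 : ψ ≠ 1 := by
      rintro rfl
      exact hψ one_ne_zero (by ext; simp)
    have hJ := jacobiSum_nontrivial_inv (complexQuadraticChar_ne_one hF)
    rw [complexQuadraticChar_isQuadratic.inv, complexQuadraticChar_neg_one h41] at hJ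
    rw [h, hJ, ← sq, ← sq, hg, complexQuadraticChar_sq, gaussSum_one_left hψ1]
    ring
  · rw [sub_zero, div_eq_iff hne', mul_comm (jacobiSum _ _)]
    refine (jacobiSum_mul_nontrivial (fun h1 ↦ h ?_) ψ).symm
    rw [eq_inv_of_mul_eq_one_left h1, complexQuadraticChar_isQuadratic.inv]

end QuadraticCharacter

section GeneratorSums

variable {F : Type*} [Field F] [Fintype F] {T : MulChar F ℂ}

lemma orderOf_mulChar_generator (hT : ∀ χ : MulChar F ℂ, χ ∈ Subgroup.zpowers T) :
    orderOf T = Fintype.card F - 1 := by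
  rw [orderOf_eq_card_of_forall_mem_zpowers hT,
    MulChar.card_eq_card_units_of_hasEnoughRootsOfUnity, Nat.card_units, Nat.card_eq_fintype_card]

lemma sum_generator_pow_apply (hT : ∀ χ : MulChar F ℂ, χ ∈ Subgroup.zpowers T)
    [DecidableEq F] {x : F} (hx : x ≠ 0) :
    ∑ j ∈ Finset.range (Fintype.card F - 1), (T ^ j) x =
      if x = 1 then (Fintype.card F - 1 : ℂ) else 0 := by
  have hpow : ∀ j, (T ^ j) x = T x ^ j := fun j ↦ T.pow_apply_coe j (Units.mk0 x hx)
  simp_rw [hpow]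
  split_ifs with h
  · simp [h, Nat.cast_sub Fintype.card_pos]
  · have h1 : T x ≠ 1 := by
      intro h1
      obtain ⟨χ, hχ⟩ := MulChar.exists_apply_ne_one_of_hasEnoughRootsOfUnity F ℂ h
      obtain ⟨k, -, rfl⟩ := (isOfFinOrder_iff_pow_eq_one.mpr
        ⟨_, T.orderOf_pos, pow_orderOf_eq_one T⟩).mem_zpowers_iff_mem_range_orderOf.mp (hT χ) |>
          Finset.mem_image.mp
      exact hχ (by rw [hpow, h1, one_pow])
    rw [geom_sum_eq h1, ← hpow, ← orderOf_mulChar_generator hT, pow_orderOf_eq_one,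
      MulChar.one_apply (isUnit_iff_ne_zero.mpr hx), sub_self, zero_div]

lemma sum_jacobiSum_generator_sq (hT : ∀ χ : MulChar F ℂ, χ ∈ Subgroup.zpowers T)
    (hF : ringChar F ≠ 2) (φ : MulChar F ℂ) :
    ∑ j ∈ Finset.range (Fintype.card F - 1), jacobiSum ((T ^ j) ^ 2) φ =
      (Fintype.card F - 1) * φ 2 := by
  classical
  simp only [jacobiSum]
  rw [Finset.sum_comm]
  have hne : (1 : F) ≠ -1 := (Ring.neg_one_ne_one_of_char_ne_two hF).symm
  calc _ = ∑ x : F, if x = 1 ∨ x = -1 then (Fintype.card F - 1 : ℂ) * φ (1 - x) else 0 := by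
        refine Finset.sum_congr rfl fun x _ ↦ ?_
        rw [← Finset.sum_mul]
        rcases eq_or_ne x 0 with rfl | hx
        · simp [MulChar.map_zero]
        · simp_rw [MulChar.pow_apply' _ two_ne_zero, ← map_pow]
          rw [sum_generator_pow_apply hT (pow_ne_zero 2 hx)]
          simp only [_root_.sq_eq_one_iff, ite_mul, zero_mul]
    _ = _ := by
        have hset : (Finset.univ.filter fun x : F ↦ x = 1 ∨ x = -1) = {1, -1} := by
          ext
          simp
        rw [← Finset.sum_filter, hset, Finset.sum_pair hne]
        simp [one_add_one_eq_two, MulChar.map_zero]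

lemma generator_pow_eq_complexQuadraticChar
    (hT : ∀ χ : MulChar F ℂ, χ ∈ Subgroup.zpowers T) {t : ℕ}
    (ht : Fintype.card F = 4 * t + 1) (ht0 : t ≠ 0) :
    T ^ (2 * t) = complexQuadraticChar F := by
  have ho := orderOf_mulChar_generator hT
  refine (MulChar.sq_eq_one_iff.mp ?_).resolve_left ?_
  · rw [← pow_mul, ← orderOf_dvd_iff_pow_eq_one, ho]
    exact ⟨1, by omega⟩
  · rw [← orderOf_dvd_iff_pow_eq_one, ho]
    intro h
    have := Nat.le_of_dvd (by omega) h
    omega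

lemma card_generator_sq_eq_complexQuadraticChar
    (hT : ∀ χ : MulChar F ℂ, χ ∈ Subgroup.zpowers T) {t : ℕ}
    (ht : Fintype.card F = 4 * t + 1) (ht0 : t ≠ 0)
    [DecidablePred fun j : ℕ ↦ (T ^ j) ^ 2 = complexQuadraticChar F] :
    ((Finset.range (Fintype.card F - 1)).filter
      fun j ↦ (T ^ j) ^ 2 = complexQuadraticChar F).card = 2 := by
  have ho := orderOf_mulChar_generator hT
  have : (Finset.range (Fintype.card F - 1)).filter
      (fun j ↦ (T ^ j) ^ 2 = complexQuadraticChar F) = {t, 3 * t} := by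
    ext j
    rw [Finset.mem_filter, Finset.mem_range, ← generator_pow_eq_complexQuadraticChar hT ht ht0,
      ← pow_mul, pow_inj_mod, ho, Finset.mem_insert, Finset.mem_singleton, ht,
      Nat.add_sub_cancel, Nat.mod_eq_of_lt (by omega : 2 * t < 4 * t)]
    constructor
    · rintro ⟨hj, h⟩
      have := Nat.div_add_mod (j * 2) (4 * t)
      have hlt : j * 2 / (4 * t) < 2 := Nat.div_lt_of_lt_mul (by omega)
      generalize j * 2 / (4 * t) = k at *
      interval_cases k <;> omega
    · rintro (rfl | rfl)
      · exact ⟨by omega, by rw [Nat.mod_eq_of_lt] <;> omega⟩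
      · refine ⟨by omega, ?_⟩
        rw [show 3 * t * 2 = 2 * t + 4 * t by ring, Nat.add_mod_right, Nat.mod_eq_of_lt]
        omega
  rw [this, Finset.card_pair (by omega)]

lemma complexQuadraticChar_two
    (hT : ∀ χ : MulChar F ℂ, χ ∈ Subgroup.zpowers T) {t : ℕ}
    (ht : Fintype.card F = 4 * t + 1) (ht0 : t ≠ 0) :
    complexQuadraticChar F 2 = (T ^ t) (-1) := by
  have h41 : Fintype.card F % 4 = 1 := by omega
  have h2 : (2 : F) ≠ 0 := Ring.two_ne_zero (ringChar_ne_two_of_card h41)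
  obtain ⟨i, hi⟩ := FiniteField.isSquare_neg_one_iff.mpr (by omega : Fintype.card F % 4 ≠ 3)
  have hi0 : i ≠ 0 := by
    rintro rfl
    simp at hi
  have hsq : (1 + i) ^ 2 = 2 * i := by linear_combination -hi
  have hmul : complexQuadraticChar F 2 * complexQuadraticChar F i = 1 := by
    rw [← map_mul, ← hsq]
    refine complexQuadraticChar_sq_apply fun h ↦ mul_ne_zero h2 hi0 ?_
    rw [← hsq, h, zero_pow two_ne_zero]
  have hii : complexQuadraticChar F i * complexQuadraticChar F i = 1 := by
    rw [← map_mul, ← sq, complexQuadraticChar_sq_apply hi0]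
  have heq : complexQuadraticChar F 2 = complexQuadraticChar F i := by
    linear_combination complexQuadraticChar F i * hmul - complexQuadraticChar F 2 * hii
  rw [heq, ← generator_pow_eq_complexQuadraticChar hT ht ht0, hi, ← sq, map_pow,
    ← MulChar.pow_apply' _ two_ne_zero, ← pow_mul, mul_comm]

end GeneratorSums

lemma exists_isPrimitive_gaussSum'_eq {F : Type*} [Field F] [Fintype F] (p : ℕ) [Fact p.Prime]
    [CharP F p] [Algebra (ZMod p) F] {ζ : ℂ} (hζ : IsPrimitiveRoot ζ p) :
    ∃ ψ : AddChar F ℂ, ψ.IsPrimitive ∧ ∀ χ, gaussSum' p ζ χ = gaussSum χ ψ := by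
  refine ⟨(AddChar.zmodChar p hζ.pow_eq_one).compAddMonoidHom
    (Algebra.trace (ZMod p) F).toAddMonoidHom, AddChar.IsPrimitive.of_ne_one fun h ↦ ?_,
    fun χ ↦ rfl⟩
  obtain ⟨x, hx⟩ := Algebra.trace_surjective (ZMod p) F 1
  have h1 : ζ ^ (Algebra.trace (ZMod p) F x).val = 1 := DFunLike.congr_fun h x
  have hp := (Fact.out : p.Prime).one_lt
  have : Fact (1 < p) := ⟨hp⟩
  rw [hx, ZMod.val_one, pow_one] at h1
  exact hζ.ne_one hp h1

/-- Corollary 4.7: for `q ≡ 1 (mod 4)`, `t = (q-1)/4`, `T` a generator of the character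
group of `F_q^×`, and `λ ∈ F_q` with `λ⁴ = 1`:
`S₂ = (3/(q-1))·∑_{j=0}^{q-2} (g(T^j)²·g(T^{2t+j})²/g(T^{4j}))·T^{4j}(4λ) = -6q + 3q·T^t(-1)`. -/
theorem S0022_eq_lambda_pow_four_eq_one
    (F : Type*) [Field F] [Fintype F] (p : ℕ) [Fact p.Prime] [CharP F p] [Algebra (ZMod p) F]
    (ζ : ℂ) (hζ : IsPrimitiveRoot ζ p)
    (q t : ℕ) (hq : q = Fintype.card F) (hq4 : q % 4 = 1) (ht : t = (q - 1) / 4)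
    (T : MulChar F ℂ) (hT : ∀ χ : MulChar F ℂ, χ ∈ Subgroup.zpowers T)
    (lam : F) (hlam : lam ^ 4 = 1) :
    (3 / ((q : ℂ) - 1)) *
        ∑ j ∈ Finset.range (q - 1),
          gaussSum' p ζ (T ^ j) ^ 2 * gaussSum' p ζ (T ^ (2 * t + j)) ^ 2 /
              gaussSum' p ζ (T ^ (4 * j)) * (T ^ (4 * j)) (4 * lam) =
      -6 * (q : ℂ) + 3 * (q : ℂ) * (T ^ t) (-1 : F) := by
  classical
  subst hq
  have hcard : Fintype.card F = 4 * t + 1 := by omega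
  have ht0 : t ≠ 0 := by
    have := Fintype.one_lt_card (α := F)
    omega
  have hF := ringChar_ne_two_of_card hq4
  obtain ⟨ψ, hψ, hg⟩ := exists_isPrimitive_gaussSum'_eq (F := F) p hζ
  have hq1 : (Fintype.card F : ℂ) - 1 ≠ 0 := by
    rw [hcard]
    push_cast
    simpa using ht0
  rw [Finset.sum_congr rfl fun j _ ↦ by
    rw [hg, hg, hg, pow_add, generator_pow_eq_complexQuadraticChar hT hcard ht0,
      Nat.mul_comm 4 j, pow_mul, gaussSum_quotient_eq_jacobiSum hq4 hψ _ hlam]]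
  rw [← Finset.mul_sum, Finset.sum_sub_distrib, sum_jacobiSum_generator_sq hT hF,
    ← Finset.sum_filter, Finset.sum_const,
    card_generator_sq_eq_complexQuadraticChar hT hcard ht0,
    complexQuadraticChar_two hT hcard ht0, nsmul_eq_mul]
  field_simp
  push_cast
  ring
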